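/- arXiv:2301.08568 — 6 statements merged into one kernel-verified Lean document; each statement's English description precedes it below -/
import Mathlib

section
/- Let f_phy : ℝ^p × ℝ^n → ℝ, f_NN : ℝ^q × ℝ^m → ℝ and T : ℝ^n → ℝ^m be functions, let R ⊆ ℝ^n, let φ_0, …, φ_{N−1} ∈ R, let θ*_phy ∈ ℝ^p, let g : ℝ^n → ℝ, and let the training targets be u_i = f_phy(θ*_phy, φ_i) + g(φ_i) for i = 0, …, N−1. Let Λ_phy ∈ ℝ^{p×p} be injective (full rank). Assume: (A1) there exists θ*_NN ∈ ℝ^q such that f_NN(θ*_NN, T(φ)) = g(φ) for all φ ∈ R; (A2) for any θ^A, θ^B ∈ ℝ^q such that f_NN(θ^A, T(φ)) ≠ f_NN(θ^B, T(φ)) for some φ ∈ R, it holds that (1/N) Σ_{i=0}^{N−1} (f_NN(θ^A, T(φ_i)) − f_NN(θ^B, T(φ_i)))² > 0. Then (θ*_phy, θ*_NN) is a global minimizer of the cost V with V(θ*_phy, θ*_NN) = 0, and every global minimizer (θ̂_phy, θ̂_NN) of V satisfies θ̂_phy = θ*_phy and f_NN(θ̂_NN, T(φ)) = g(φ) for all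 φ ∈ R. -/
open Finset

/-- **PGNN consistency** (Proposition 1 of the paper).
The PGNN model `û(θ, φ) = f_phy(θ.1, φ) + f_NN(θ.2, T φ)` is trained with the
regularized cost `V(θ) = (1/N) ∑ᵢ (uᵢ - û(θ, φᵢ))² + ‖Λ_phy (θ.1 - θ*_phy)‖₂²`
(`Λ_NN = 0`).  Under the model-class assumption (A1), persistence of excitation (A2),
and injectivity (full rank) of `Λ_phy`, the pair `(θ*_phy, θ*_NN)` is a global
minimizer of `V` with `V = 0`, and every global minimizer recovers `θ*_phy` exactly
and the unknown dynamics `g` on all of `R`. -/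
theorem pgnn_consistency
    {p q n m N : ℕ} (hN : 0 < N)
    (f_phy : (Fin p → ℝ) → (Fin n → ℝ) → ℝ)
    (f_NN : (Fin q → ℝ) → (Fin m → ℝ) → ℝ)
    (T : (Fin n → ℝ) → (Fin m → ℝ))
    (R : Set (Fin n → ℝ))
    (φ : Fin N → (Fin n → ℝ)) (hφ : ∀ i, φ i ∈ R)
    (θphyStar : Fin p → ℝ)
    (g : (Fin n → ℝ) → ℝ)
    (u : Fin N → ℝ)
    (hu : ∀ i, u i = f_phy θphyStar (φ i) + g (φ i))
    (Λphy : Matrix (Fin p) (Fin p) ℝ)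
    (hΛ : Function.Injective Λphy.mulVec)
    (V : (Fin p → ℝ) × (Fin q → ℝ) → ℝ)
    (hV : ∀ θ, V θ = (1 / (N : ℝ)) * ∑ i, (u i - (f_phy θ.1 (φ i) + f_NN θ.2 (T (φ i)))) ^ 2
        + ∑ j, (Λphy.mulVec (θ.1 - θphyStar) j) ^ 2)
    (θNNStar : Fin q → ℝ)
    (hA1 : ∀ φ' ∈ R, f_NN θNNStar (T φ') = g φ')
    (hA2 : ∀ θA θB : Fin q → ℝ,
      (∃ φ' ∈ R, f_NN θA (T φ') ≠ f_NN θB (T φ')) →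
      (1 / (N : ℝ)) * ∑ i, (f_NN θA (T (φ i)) - f_NN θB (T (φ i))) ^ 2 > 0) :
    (V (θphyStar, θNNStar) = 0 ∧ ∀ θ, V (θphyStar, θNNStar) ≤ V θ) ∧
    ∀ θhat : (Fin p → ℝ) × (Fin q → ℝ), (∀ θ, V θhat ≤ V θ) →
      θhat.1 = θphyStar ∧ ∀ φ' ∈ R, f_NN θhat.2 (T φ') = g φ' := by
  have hzero : V (θphyStar, θNNStar) = 0 := by
    simp [hV, hu, hA1 _ (hφ _)]
  have hMSE : ∀ θ : (Fin p → ℝ) × (Fin q → ℝ),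
      0 ≤ (1 / (N : ℝ)) * ∑ i, (u i - (f_phy θ.1 (φ i) + f_NN θ.2 (T (φ i)))) ^ 2 :=
    fun θ => by positivity
  have hReg : ∀ θ : (Fin p → ℝ) × (Fin q → ℝ),
      0 ≤ ∑ j, (Λphy.mulVec (θ.1 - θphyStar) j) ^ 2 :=
    fun θ => by positivity
  refine ⟨⟨hzero, fun θ => ?_⟩, fun θhat hmin => ?_⟩
  · rw [hzero, hV]
    exact add_nonneg (hMSE θ) (hReg θ)
  · have hle : V θhat ≤ 0 := hzero ▸ hmin (θphyStar, θNNStar)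
    rw [hV] at hle
    have hReg0 : ∑ j, (Λphy.mulVec (θhat.1 - θphyStar) j) ^ 2 = 0 := by
      linarith [hMSE θhat, hReg θhat]
    have hphy : θhat.1 = θphyStar := by
      rw [Finset.sum_eq_zero_iff_of_nonneg fun _ _ => sq_nonneg _] at hReg0
      refine sub_eq_zero.mp (hΛ ?_)
      rw [Matrix.mulVec_zero]
      exact funext fun j => pow_eq_zero_iff two_ne_zero |>.mp (hReg0 j (Finset.mem_univ j))
    refine ⟨hphy, fun φ' hφ' => ?_⟩
    by_contra hne
    have hpos := hA2 θNNStar θhat.2 ⟨φ', hφ', fun h => hne (h ▸ hA1 φ' hφ')⟩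
    have hresidual : ∀ i, u i - (f_phy θhat.1 (φ i) + f_NN θhat.2 (T (φ i)))
        = f_NN θNNStar (T (φ i)) - f_NN θhat.2 (T (φ i)) := fun i => by
      rw [hu, hphy, hA1 _ (hφ i)]
      ring
    simp only [hresidual] at hle
    linarith [hReg θhat]
end

section
/- Let θ_NL ∈ ℝ^{n₁} be fixed and suppose M(θ_NL) is nonsingular. Define θ_L^opt = M(θ_NL)^{−1} ( (1/N) Σ_{i=0}^{N−1} u_i φ_L(θ_NL, φ_i) + (Λ_L² + ΛᵀΛ) θ̄_L − (ΛᵀΛ_NL + Λ_L Λᵀ) θ_NL ). Then V((θ_NL, θ_L^opt)) ≤ V((θ_NL, θ̄_L)), and the inequality is strict if and only if (1/N) Σ_{i=0}^{N−1} ( u_i φ_L(θ_NL, φ_i) − φ_L(θ_NL, φ_i) φ_L(θ_NL, φ_i)ᵀ θ̄_L ) − (ΛᵀΛ_NL + Λ_L Λᵀ) θ_NL ≠ 0. -/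
open Finset Matrix

lemma dotProduct_vecMulVec_mulVec {ι : Type*} [Fintype ι] (x a b y : ι → ℝ) :
    x ⬝ᵥ (vecMulVec a b *ᵥ y) = (x ⬝ᵥ a) * (b ⬝ᵥ y) := by
  rw [vecMulVec_mulVec, op_smul_eq_smul, dotProduct_smul, smul_eq_mul, mul_comm]

lemma dotProduct_transpose_mul_mulVec {ι κ l : Type*} [Fintype ι] [Fintype κ] [Fintype l]
    (A : Matrix κ ι ℝ) (B : Matrix κ l ℝ) (x : ι → ℝ) (y : l → ℝ) :
    x ⬝ᵥ ((Aᵀ * B) *ᵥ y) = (A *ᵥ x) ⬝ᵥ (B *ᵥ y) := by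
  rw [← mulVec_mulVec, dotProduct_mulVec, vecMul_transpose]

lemma sum_add_sq_eq {ι : Type*} [Fintype ι] (a b : ι → ℝ) :
    ∑ i, ((a + b) i) ^ 2 = ∑ i, (a i) ^ 2 + 2 * (b ⬝ᵥ a) + b ⬝ᵥ b := by
  simp only [dotProduct, mul_sum, ← sum_add_distrib, Pi.add_apply]
  exact sum_congr rfl fun i _ => by ring

lemma posSemidef_smul_sum_vecMulVec {ι κ : Type*} [Fintype ι] [Fintype κ]
    {c : ℝ} (hc : 0 ≤ c) (a : κ → ι → ℝ) :
    (c • ∑ i, vecMulVec (a i) (a i)).PosSemidef :=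
  (posSemidef_sum _ fun i _ => by simpa using posSemidef_vecMulVec_self_star (a i)).smul hc

/-- Exact second-order expansion of the average squared error of a linear model. -/
lemma mul_sum_sub_dotProduct_add_sq {ι κ : Type*} [Fintype ι] [Fintype κ]
    (c : ℝ) (u : κ → ℝ) (a : κ → ι → ℝ) (y x : ι → ℝ) :
    c * ∑ i, (u i - (y + x) ⬝ᵥ a i) ^ 2 = c * ∑ i, (u i - y ⬝ᵥ a i) ^ 2
      - 2 * (x ⬝ᵥ (c • ∑ i, (u i • a i - vecMulVec (a i) (a i) *ᵥ y)))
      + x ⬝ᵥ ((c • ∑ i, vecMulVec (a i) (a i)) *ᵥ x) := by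
  simp only [smul_mulVec, sum_mulVec, dotProduct_smul, dotProduct_sum, dotProduct_sub,
    dotProduct_vecMulVec_mulVec, smul_eq_mul, mul_sum, ← sum_add_distrib, ← sum_sub_distrib]
  refine sum_congr rfl fun i _ => ?_
  rw [add_dotProduct, dotProduct_comm (a i) y, dotProduct_comm (a i) x]
  ring

/-- **Optimized PGNN parameter selection** (Proposition 2, first part).
For the LIP PGNN `û((θNL, θL), φ) = θL ⬝ᵥ φL(θNL, φ)` with regularized cost
`V = V_MSE + V_reg`, if `M(θNL)` is nonsingular and `θLopt` is the least-squares
choice, then `V (θNL, θLopt) ≤ V (θNL, θ̄L)`, with strict inequality iff the stated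
vector is nonzero. -/
theorem pgnn_optimized_parameter_selection
    {n n₁ m N : ℕ} (hN : 0 < N)
    (φ : Fin N → (Fin n → ℝ)) (u : Fin N → ℝ)
    (φL : (Fin n₁ → ℝ) → (Fin n → ℝ) → (Fin m → ℝ))
    (ΛNL : Matrix (Fin n₁) (Fin n₁) ℝ) (hΛNL : ΛNLᵀ = ΛNL)
    (ΛL : Matrix (Fin m) (Fin m) ℝ) (hΛL : ΛLᵀ = ΛL)
    (Λ : Matrix (Fin n₁) (Fin m) ℝ)
    (θbarL : Fin m → ℝ)
    (VMSE : (Fin n₁ → ℝ) × (Fin m → ℝ) → ℝ)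
    (hVMSE : ∀ θ, VMSE θ = (1 / (N : ℝ)) * ∑ i, (u i - θ.2 ⬝ᵥ φL θ.1 (φ i)) ^ 2)
    (Vreg : (Fin n₁ → ℝ) × (Fin m → ℝ) → ℝ)
    (hVreg : ∀ θ, Vreg θ =
        (∑ i, ((ΛNL.mulVec θ.1 + Λ.mulVec (θ.2 - θbarL)) i) ^ 2)
      + (∑ j, ((Λᵀ.mulVec θ.1 + ΛL.mulVec (θ.2 - θbarL)) j) ^ 2))
    (V : (Fin n₁ → ℝ) × (Fin m → ℝ) → ℝ) (hV : ∀ θ, V θ = VMSE θ + Vreg θ)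
    (θNL : Fin n₁ → ℝ)
    (M : Matrix (Fin m) (Fin m) ℝ)
    (hM : M = (1 / (N : ℝ)) • (∑ i, vecMulVec (φL θNL (φ i)) (φL θNL (φ i)))
        + ΛL * ΛL + Λᵀ * Λ)
    (hMns : IsUnit M)
    (θLopt : Fin m → ℝ)
    (hθLopt : θLopt = M⁻¹.mulVec
      ((1 / (N : ℝ)) • (∑ i, u i • φL θNL (φ i))
        + (ΛL * ΛL + Λᵀ * Λ).mulVec θbarL
        - (Λᵀ * ΛNL + ΛL * Λᵀ).mulVec θNL)) :
    V (θNL, θLopt) ≤ V (θNL, θbarL) ∧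
    (V (θNL, θLopt) < V (θNL, θbarL) ↔
      (1 / (N : ℝ)) • (∑ i, (u i • φL θNL (φ i)
          - (vecMulVec (φL θNL (φ i)) (φL θNL (φ i))).mulVec θbarL))
        - (Λᵀ * ΛNL + ΛL * Λᵀ).mulVec θNL ≠ 0) := by
  set S : Matrix (Fin m) (Fin m) ℝ :=
    (1 / (N : ℝ)) • ∑ i, vecMulVec (φL θNL (φ i)) (φL θNL (φ i)) with hS
  set g : Fin m → ℝ := (1 / (N : ℝ)) • (∑ i, (u i • φL θNL (φ i)
      - (vecMulVec (φL θNL (φ i)) (φL θNL (φ i))).mulVec θbarL))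
    - (Λᵀ * ΛNL + ΛL * Λᵀ).mulVec θNL with hg
  obtain ⟨x, rfl⟩ : ∃ x, θLopt = θbarL + x := ⟨θLopt - θbarL, by simp⟩
  have hMpos : M.PosDef := by
    have hpsd : M.PosSemidef := by
      rw [hM]
      refine ((posSemidef_smul_sum_vecMulVec (by positivity) _).add ?_).add ?_
      · simpa [conjTranspose_eq_transpose_of_trivial, hΛL] using
          posSemidef_conjTranspose_mul_self ΛL
      · simpa [conjTranspose_eq_transpose_of_trivial] using posSemidef_conjTranspose_mul_self Λ
    exact hpsd.posDef_iff_isUnit.mpr hMns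
  have hMx : M *ᵥ x = g := by
    have h := congrArg (M *ᵥ ·) hθLopt
    simp only [mulVec_mulVec, mul_nonsing_inv M ((isUnit_iff_isUnit_det M).mp hMns),
      one_mulVec, mulVec_add] at h
    have hSy : S *ᵥ θbarL = (1 / (N : ℝ)) •
        ∑ i, (vecMulVec (φL θNL (φ i)) (φL θNL (φ i))) *ᵥ θbarL := by
      rw [hS, smul_mulVec, sum_mulVec]
    have hMy : M *ᵥ θbarL = S *ᵥ θbarL + (ΛL * ΛL + Λᵀ * Λ) *ᵥ θbarL := by
      rw [hM, add_assoc, add_mulVec]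
    rw [hg, sum_sub_distrib, smul_sub, ← hSy, eq_sub_of_add_eq' h, hMy]
    abel
  have hexp : V (θNL, θbarL + x) = V (θNL, θbarL) - 2 * (x ⬝ᵥ g) + x ⬝ᵥ (M *ᵥ x) := by
    have hΛ := dotProduct_transpose_mul_mulVec Λ ΛNL x θNL
    have hL := dotProduct_transpose_mul_mulVec ΛL Λᵀ x θNL
    have hΛΛ := dotProduct_transpose_mul_mulVec Λ Λ x x
    have hLL := dotProduct_transpose_mul_mulVec ΛL ΛL x x
    rw [hΛL] at hL hLL
    simp only [hV, hVMSE, hVreg, add_sub_cancel_left, sub_self, mulVec_zero, add_zero]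
    rw [mul_sum_sub_dotProduct_add_sq, sum_add_sq_eq, sum_add_sq_eq, hM, hg]
    simp only [dotProduct_sub, dotProduct_add, add_mulVec, hΛ, hL, hΛΛ, hLL]
    ring
  rw [← hMx] at hexp ⊢
  have hnonneg : 0 ≤ x ⬝ᵥ (M *ᵥ x) := by
    simpa using hMpos.posSemidef.dotProduct_mulVec_nonneg x
  refine ⟨by linarith, fun h h0 => ?_, fun h => ?_⟩
  · rw [h0, dotProduct_zero] at hexp
    linarith
  · have hx : x ≠ 0 := by
      rintro rfl
      exact h (mulVec_zero M)
    have hpos : 0 < x ⬝ᵥ (M *ᵥ x) := by simpa using hMpos.dotProduct_mulVec_pos hx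
    linarith
end

section
/- Let θ_NL ∈ ℝ^{n₁} be fixed, suppose M(θ_NL) is nonsingular, suppose Λ = 0, and define θ_L^opt = M(θ_NL)^{−1} ( (1/N) Σ_{i=0}^{N−1} u_i φ_L(θ_NL, φ_i) + Λ_L² θ̄_L ). Then the mean-squared error improves: V_MSE((θ_NL, θ_L^opt)) ≤ V_MSE((θ_NL, θ̄_L)), with strict inequality if (1/N) Σ_{i=0}^{N−1} ( u_i φ_L(θ_NL, φ_i) − φ_L(θ_NL, φ_i) φ_L(θ_NL, φ_i)ᵀ θ̄_L ) ≠ 0. -/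
open Finset Matrix

/-- If `d` solves the regularized normal equations for the residuals `r`, then correcting the
residuals by `d` decreases the sum of squares by a sum of nonnegative terms. -/
lemma sum_sq_sub_sum_sq_of_normal_equations {ι κ : Type*} [Fintype ι] [Fintype κ]
    (c : ℝ) (p : ι → κ → ℝ) (r : ι → ℝ) (L : Matrix κ κ ℝ) (hL : Lᵀ = L) (d : κ → ℝ)
    (hd : c • ∑ i, (d ⬝ᵥ p i) • p i + L *ᵥ (L *ᵥ d) = c • ∑ i, r i • p i) :
    c * ∑ i, r i ^ 2 - c * ∑ i, (r i - d ⬝ᵥ p i) ^ 2 =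
      c * ∑ i, (d ⬝ᵥ p i) ^ 2 + 2 * (L *ᵥ d ⬝ᵥ L *ᵥ d) := by
  have hdot := congrArg (d ⬝ᵥ ·) hd
  have hLd : d ⬝ᵥ L *ᵥ (L *ᵥ d) = L *ᵥ d ⬝ᵥ L *ᵥ d := by
    rw [dotProduct_mulVec, ← mulVec_transpose, hL]
  simp only [dotProduct_add, dotProduct_smul, dotProduct_sum, smul_eq_mul, hLd] at hdot
  have hexp : ∑ i, (r i - d ⬝ᵥ p i) ^ 2 =
      ∑ i, r i ^ 2 - 2 * ∑ i, r i * (d ⬝ᵥ p i) + ∑ i, (d ⬝ᵥ p i) * (d ⬝ᵥ p i) := by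
    rw [mul_sum, ← sum_sub_distrib, ← sum_add_distrib]
    exact sum_congr rfl fun i _ => by ring
  have hsq : ∑ i, (d ⬝ᵥ p i) ^ 2 = ∑ i, (d ⬝ᵥ p i) * (d ⬝ᵥ p i) :=
    sum_congr rfl fun i _ => sq _
  rw [hexp, hsq]
  linear_combination -2 * hdot

lemma vecMulVec_self_mulVec {κ : Type*} [Fintype κ] (p d : κ → ℝ) :
    vecMulVec p p *ᵥ d = (d ⬝ᵥ p) • p := by
  rw [vecMulVec_mulVec, dotProduct_comm]
  ext j
  simp [mul_comm]

/-- **PGNN improves over physics** (Proposition 2, second part).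
For the LIP PGNN with `Λ = 0` (no regularization of the cross terms between
`θNL` and `θL`), the least-squares choice `θLopt` achieves a better data fit
(mean-squared error) than the physics-based parameters `θ̄L`, with strict
inequality if the stated vector is nonzero. -/
theorem pgnn_improves_over_physics
    {n n₁ m N : ℕ} (hN : 0 < N)
    (φ : Fin N → (Fin n → ℝ)) (u : Fin N → ℝ)
    (φL : (Fin n₁ → ℝ) → (Fin n → ℝ) → (Fin m → ℝ))
    (ΛNL : Matrix (Fin n₁) (Fin n₁) ℝ) (hΛNL : ΛNLᵀ = ΛNL)
    (ΛL : Matrix (Fin m) (Fin m) ℝ) (hΛL : ΛLᵀ = ΛL)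
    (Λ : Matrix (Fin n₁) (Fin m) ℝ) (hΛ0 : Λ = 0)
    (θbarL : Fin m → ℝ)
    (VMSE : (Fin n₁ → ℝ) × (Fin m → ℝ) → ℝ)
    (hVMSE : ∀ θ, VMSE θ = (1 / (N : ℝ)) * ∑ i, (u i - θ.2 ⬝ᵥ φL θ.1 (φ i)) ^ 2)
    (Vreg : (Fin n₁ → ℝ) × (Fin m → ℝ) → ℝ)
    (hVreg : ∀ θ, Vreg θ =
        (∑ i, ((ΛNL.mulVec θ.1 + Λ.mulVec (θ.2 - θbarL)) i) ^ 2)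
      + (∑ j, ((Λᵀ.mulVec θ.1 + ΛL.mulVec (θ.2 - θbarL)) j) ^ 2))
    (V : (Fin n₁ → ℝ) × (Fin m → ℝ) → ℝ) (hV : ∀ θ, V θ = VMSE θ + Vreg θ)
    (θNL : Fin n₁ → ℝ)
    (M : Matrix (Fin m) (Fin m) ℝ)
    (hM : M = (1 / (N : ℝ)) • (∑ i, vecMulVec (φL θNL (φ i)) (φL θNL (φ i)))
        + ΛL * ΛL + Λᵀ * Λ)
    (hMns : IsUnit M)
    (θLopt : Fin m → ℝ)
    (hθLopt : θLopt = M⁻¹.mulVec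
      ((1 / (N : ℝ)) • (∑ i, u i • φL θNL (φ i)) + (ΛL * ΛL).mulVec θbarL)) :
    VMSE (θNL, θLopt) ≤ VMSE (θNL, θbarL) ∧
    ((1 / (N : ℝ)) • (∑ i, (u i • φL θNL (φ i)
          - (vecMulVec (φL θNL (φ i)) (φL θNL (φ i))).mulVec θbarL)) ≠ 0 →
      VMSE (θNL, θLopt) < VMSE (θNL, θbarL)) := by
  subst hΛ0
  set c : ℝ := 1 / (N : ℝ) with hc
  have hcpos : 0 < c := by positivity
  set p : Fin N → Fin m → ℝ := fun i => φL θNL (φ i) with hp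
  set r : Fin N → ℝ := fun i => u i - θbarL ⬝ᵥ p i with hr
  set d : Fin m → ℝ := θLopt - θbarL with hd
  have hMv (v : Fin m → ℝ) : M *ᵥ v = c • ∑ i, (v ⬝ᵥ p i) • p i + ΛL *ᵥ (ΛL *ᵥ v) := by
    simp [hM, add_mulVec, smul_mulVec, sum_mulVec, vecMulVec_self_mulVec, mulVec_mulVec, hp]
  have hopt : M *ᵥ θLopt = c • ∑ i, u i • p i + (ΛL * ΛL) *ᵥ θbarL := by
    rw [hθLopt, mulVec_mulVec, mul_nonsing_inv _ ((isUnit_iff_isUnit_det _).1 hMns), one_mulVec]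
  have hnormal : c • ∑ i, (d ⬝ᵥ p i) • p i + ΛL *ᵥ (ΛL *ᵥ d) = c • ∑ i, r i • p i := by
    rw [← hMv, hd, mulVec_sub, hopt, hMv, ← mulVec_mulVec]
    simp only [hr, sub_smul, sum_sub_distrib, smul_sub]
    abel
  have hgap := sum_sq_sub_sum_sq_of_normal_equations c p r ΛL hΛL d hnormal
  have hbar : VMSE (θNL, θbarL) = c * ∑ i, r i ^ 2 := hVMSE _
  have hfit : VMSE (θNL, θLopt) = c * ∑ i, (r i - d ⬝ᵥ p i) ^ 2 := by
    rw [hVMSE]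
    simp [hr, hd, hp, sub_dotProduct]
  have hsum : 0 ≤ ∑ i, (d ⬝ᵥ p i) ^ 2 := sum_nonneg fun i _ => sq_nonneg _
  have hquad : 0 ≤ c * ∑ i, (d ⬝ᵥ p i) ^ 2 := mul_nonneg hcpos.le hsum
  have hreg : 0 ≤ ΛL *ᵥ d ⬝ᵥ ΛL *ᵥ d := sum_nonneg fun j _ => mul_self_nonneg _
  refine ⟨by linarith, fun hne => ?_⟩
  by_contra hlt
  apply hne
  have hquad0 : c * ∑ i, (d ⬝ᵥ p i) ^ 2 = 0 := by linarith
  have hLd : ΛL *ᵥ d = 0 := dotProduct_self_eq_zero.1 (by linarith)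
  have hdp (i : Fin N) : d ⬝ᵥ p i = 0 := by
    have hsum0 := (mul_eq_zero.1 hquad0).resolve_left hcpos.ne'
    exact pow_eq_zero_iff two_ne_zero |>.1
      ((sum_eq_zero_iff_of_nonneg fun i _ => sq_nonneg _).1 hsum0 i (mem_univ i))
  have hzero : c • ∑ i, r i • p i = 0 := by
    simp [← hnormal, hdp, hLd]
  simpa only [vecMulVec_self_mulVec, ← sub_smul] using hzero
end

section
/- Let L ≥ 1, let n_0, …, n_L be positive integers with output dimension n_{L+1} = 1, let W_l ∈ ℝ^{n_l × n_{l−1}} and b_l ∈ ℝ^{n_l} for l = 1, …, L+1, and for each l = 1, …, L let α_l : ℝ^{n_l} → ℝ^{n_l} act componentwise by scalar functions each of which is 1-Lipschitz. Define the scalar-output feedforward neural network f(x) = W_{L+1} α_L( W_L α_{L−1}( ⋯ α_1( W_1 x + b_1 ) ⋯ ) + b_L ) + b_{L+1}. Then for all x, y ∈ ℝ^{n_0}: |f(x) − f(y)| ≤ (|W_{L+1}| |W_L| ⋯ |W_1|) |x − y|, where |·| applied to a matrix or vector denotes the entrywise absolute value, so that |W_{L+1}| ⋯ |W_1| is a 1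 × n_0 row vector of nonnegative entries and the right-hand side is its product with the vector |x − y|. -/
open Finset Matrix

/-- The hidden part of a feedforward neural network: `netHidden nd W b a l x` is
the output of layer `l` (dimension `nd l`), obtained from the input `x ∈ ℝ^{nd 0}`
by alternating affine maps `z ↦ W l *ᵥ z + b l` and componentwise activation
layers `a l`. -/
def netHidden (nd : ℕ → ℕ)
    (W : ∀ l : ℕ, Matrix (Fin (nd (l + 1))) (Fin (nd l)) ℝ)
    (b : ∀ l : ℕ, Fin (nd (l + 1)) → ℝ)
    (a : ∀ l : ℕ, Fin (nd (l + 1)) → ℝ → ℝ) :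
    (l : ℕ) → (Fin (nd 0) → ℝ) → (Fin (nd l) → ℝ)
  | 0 => fun x => x
  | (l + 1) => fun x i => a l i (((W l).mulVec (netHidden nd W b a l x) + b l) i)

/-- `absWeightProd nd W l = |W l| * ⋯ * |W 1|` : the product of the entrywise
absolute values of the first `l` weight matrices. -/
def absWeightProd (nd : ℕ → ℕ)
    (W : ∀ l : ℕ, Matrix (Fin (nd (l + 1))) (Fin (nd l)) ℝ) :
    (l : ℕ) → Matrix (Fin (nd l)) (Fin (nd 0)) ℝ
  | 0 => 1
  | (l + 1) => (Matrix.of fun i j => |W l i j|) * absWeightProd nd W l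

/-- A dot product is Lipschitz in its second argument, with the entrywise constant `|w|`. -/
theorem abs_dotProduct_sub_dotProduct_le {ι : Type*} [Fintype ι] (w u v d : ι → ℝ)
    (h : ∀ j, |u j - v j| ≤ d j) :
    |w ⬝ᵥ u - w ⬝ᵥ v| ≤ (fun j => |w j|) ⬝ᵥ d := by
  rw [← dotProduct_sub]
  refine (abs_sum_le_sum_abs _ _).trans (sum_le_sum fun j _ => ?_)
  rw [abs_mul]
  exact mul_le_mul_of_nonneg_left (h j) (abs_nonneg _)

/-- Entrywise Lipschitz bound for the hidden layers of a network. -/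
theorem abs_netHidden_sub_le (nd : ℕ → ℕ)
    (W : ∀ l : ℕ, Matrix (Fin (nd (l + 1))) (Fin (nd l)) ℝ)
    (b : ∀ l : ℕ, Fin (nd (l + 1)) → ℝ)
    (a : ∀ l : ℕ, Fin (nd (l + 1)) → ℝ → ℝ) (x y : Fin (nd 0) → ℝ) (l : ℕ)
    (ha : ∀ k, k < l → ∀ i, LipschitzWith 1 (a k i)) (i : Fin (nd l)) :
    |netHidden nd W b a l x i - netHidden nd W b a l y i| ≤
      (absWeightProd nd W l *ᵥ fun j => |x j - y j|) i := by
  induction l with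
  | zero => simp [netHidden, absWeightProd]
  | succ l ih =>
    have hlip := (ha l l.lt_succ_self i).dist_le_mul
      ((W l *ᵥ netHidden nd W b a l x + b l) i) ((W l *ᵥ netHidden nd W b a l y + b l) i)
    simp only [Real.dist_eq, NNReal.coe_one, one_mul, Pi.add_apply,
      add_sub_add_right_eq_sub] at hlip
    rw [absWeightProd, ← mulVec_mulVec]
    exact hlip.trans (abs_dotProduct_sub_dotProduct_le (W l i) _ _ _
      (ih fun k hk => ha k (hk.trans l.lt_succ_self)))

/-- **Entrywise Lipschitz bound for scalar-output feedforward neural networks.**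
For a network `f(x) = W_{L+1} α_L(⋯ α_1(W_1 x + b_1) ⋯) + b_{L+1}` with `L ≥ 1`
hidden layers and componentwise `1`-Lipschitz activation functions, we have
`|f(x) − f(y)| ≤ Kᵀ |x − y|` with the entrywise bound
`Kᵀ = |W_{L+1}| |W_L| ⋯ |W_1|`. -/
theorem nn_entrywise_lipschitz
    (L : ℕ) (hL : 1 ≤ L)
    (nd : ℕ → ℕ) (hnd : ∀ l, 0 < nd l)
    (W : ∀ l : ℕ, Matrix (Fin (nd (l + 1))) (Fin (nd l)) ℝ)
    (b : ∀ l : ℕ, Fin (nd (l + 1)) → ℝ)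
    (a : ∀ l : ℕ, Fin (nd (l + 1)) → ℝ → ℝ)
    (ha : ∀ l, l < L → ∀ i, LipschitzWith 1 (a l i))
    (wout : Fin (nd L) → ℝ) (bout : ℝ)
    (f : (Fin (nd 0) → ℝ) → ℝ)
    (hf : ∀ x, f x = wout ⬝ᵥ netHidden nd W b a L x + bout)
    (K : Fin (nd 0) → ℝ)
    (hK : K = Matrix.vecMul (fun j => |wout j|) (absWeightProd nd W L)) :
    ∀ x y : Fin (nd 0) → ℝ, |f x - f y| ≤ ∑ i, K i * |x i - y i| := by
  intro x y
  rw [hf, hf, add_sub_add_right_eq_sub, hK]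
  refine (abs_dotProduct_sub_dotProduct_le wout _ _ _
    (abs_netHidden_sub_le nd W b a x y L ha)).trans_eq ?_
  rw [dotProduct_mulVec]
  rfl
end

section
/- Let A ∈ ℝ^{n×n}, B ∈ ℝ^n, θ_r ∈ ℝ^p, let P ∈ ℝ^{n×n} be symmetric positive definite with Q := P − AᵀPA positive definite, and let f : ℝ^p × ℝ^n → ℝ satisfy f(0, 0) = 0 and the entrywise Lipschitz bound |f(r, x) − f(r′, x′)| ≤ K_rᵀ |r − r′| + K_uᵀ |x − x′| for all r, r′ ∈ ℝ^p and x, x′ ∈ ℝ^n, where K_r ∈ ℝ^p and K_u ∈ ℝ^n have nonnegative entries and |·| is the entrywise absolute value. Let β, β₁, β₂ > 0 and c_β := BᵀPB + (1/(β λ_min(Q))) BᵀPA AᵀP B. Then for all x ∈ ℝ^n and r ∈ ℝ^p, with x⁺ := A x + B (θ_rᵀ r + f(r, x)): x⁺ᵀ P x⁺ − xᵀ P x ≤ −( (1−β) λ_min(Q) − c_β (1+β₁)(1+β₂) K_uᵀK_u ) ‖x‖₂² + c_β ( (1+β₁)(1 + 1/β₂) K_rᵀK_r + (1 + 1/β₁)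 ‖θ_r‖₂² ) ‖r‖₂². -/
open Matrix Finset

open scoped MatrixOrder in
/-- The quadratic form of a Hermitian real matrix dominates any lower bound of its eigenvalues
times the squared Euclidean norm. -/
theorem mul_dotProduct_self_le_of_le_eigenvalues {ι : Type*} [Fintype ι] [DecidableEq ι]
    {Q : Matrix ι ι ℝ} (hQ : Q.IsHermitian) {c : ℝ} (hc : ∀ i, c ≤ hQ.eigenvalues i)
    (x : ι → ℝ) : c * (x ⬝ᵥ x) ≤ x ⬝ᵥ Q *ᵥ x := by
  have hle : algebraMap ℝ (Matrix ι ι ℝ) c ≤ Q := by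
    refine (algebraMap_le_iff_le_spectrum (a := Q) hQ).2 ?_
    rw [hQ.spectrum_real_eq_range_eigenvalues]
    rintro _ ⟨i, rfl⟩
    exact hc i
  have h := (Matrix.le_iff.1 hle).dotProduct_mulVec_nonneg x
  rw [star_trivial, sub_mulVec, dotProduct_sub, Algebra.algebraMap_eq_smul_one, smul_mulVec,
    one_mulVec, dotProduct_smul, smul_eq_mul] at h
  linarith

/-- Young's inequality for the square of a sum. -/
theorem add_sq_le_young {ε : ℝ} (hε : 0 < ε) (a b : ℝ) :
    (a + b) ^ 2 ≤ (1 + ε) * a ^ 2 + (1 + 1 / ε) * b ^ 2 := by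
  have h : (1 + ε) * a ^ 2 + (1 + 1 / ε) * b ^ 2 - (a + b) ^ 2 = (ε * a - b) ^ 2 / ε := by
    field_simp
    ring
  have : 0 ≤ (ε * a - b) ^ 2 / ε := by positivity
  linarith

/-- Young's inequality for a scaled Euclidean inner product. -/
theorem two_mul_dotProduct_le_young {ι : Type*} [Fintype ι] {ε : ℝ} (hε : 0 < ε) (w : ℝ)
    (u x : ι → ℝ) :
    2 * w * (u ⬝ᵥ x) ≤ ε * (x ⬝ᵥ x) + 1 / ε * (u ⬝ᵥ u) * w ^ 2 := by
  simp only [dotProduct, Finset.mul_sum, Finset.sum_mul, ← Finset.sum_add_distrib]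
  refine Finset.sum_le_sum fun i _ => ?_
  have h : ε * (x i * x i) + 1 / ε * (u i * u i) * w ^ 2 - 2 * w * (u i * x i)
      = (ε * x i - w * u i) ^ 2 / ε := by
    field_simp
    ring
  have : 0 ≤ (ε * x i - w * u i) ^ 2 / ε := by positivity
  linarith

/-- The difference `x⁺ᵀPx⁺ - xᵀPx` along `x⁺ = A x + w B`, expanded for symmetric `P`. -/
theorem lyapunov_difference_eq {ι : Type*} [Fintype ι] {P : Matrix ι ι ℝ} (hP : Pᵀ = P)
    (A : Matrix ι ι ℝ) (B x : ι → ℝ) (w : ℝ) :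
    (A *ᵥ x + w • B) ⬝ᵥ P *ᵥ (A *ᵥ x + w • B) - x ⬝ᵥ P *ᵥ x
      = -(x ⬝ᵥ (P - Aᵀ * P * A) *ᵥ x) + 2 * w * (((Aᵀ * P) *ᵥ B) ⬝ᵥ x)
        + w ^ 2 * (B ⬝ᵥ P *ᵥ B) := by
  have hAA : (A *ᵥ x) ⬝ᵥ P *ᵥ A *ᵥ x = x ⬝ᵥ (Aᵀ * P * A) *ᵥ x := by
    rw [← mulVec_mulVec, ← mulVec_mulVec, dotProduct_mulVec x Aᵀ, vecMul_transpose]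
  have hAB : (A *ᵥ x) ⬝ᵥ P *ᵥ B = ((Aᵀ * P) *ᵥ B) ⬝ᵥ x := by
    rw [dotProduct_comm _ x, ← mulVec_mulVec, dotProduct_mulVec x Aᵀ, vecMul_transpose]
  have hBA : B ⬝ᵥ P *ᵥ A *ᵥ x = ((Aᵀ * P) *ᵥ B) ⬝ᵥ x := by
    rw [← hAB, dotProduct_mulVec, ← mulVec_transpose, hP, dotProduct_comm]
  simp only [mulVec_add, mulVec_smul, add_dotProduct, dotProduct_add, smul_dotProduct,
    dotProduct_smul, smul_eq_mul, sub_mulVec, dotProduct_sub, hAA, hAB, hBA]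
  ring

/-- **Lyapunov difference bound for the PGNN feedforward closed-loop map**
`x⁺ = A x + B (θ_rᵀ r + f(r, x))`, where the neural layer `f` satisfies
`f(0,0) = 0` and an entrywise Lipschitz bound with nonnegative vectors `K_r, K_u`.
For `P` symmetric positive definite with `Q := P − AᵀPA` positive definite,
`λ_min(Q)` its smallest eigenvalue, and any `β, β₁, β₂ > 0`:
`x⁺ᵀPx⁺ − xᵀPx ≤ −((1−β) λ_min(Q) − c_β (1+β₁)(1+β₂) K_uᵀK_u) ‖x‖₂²
  + c_β ((1+β₁)(1+1/β₂) K_rᵀK_r + (1+1/β₁) ‖θ_r‖₂²) ‖r‖₂²`. -/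
theorem pgnn_lyapunov_difference_bound {n p : ℕ}
    (A : Matrix (Fin n) (Fin n) ℝ) (B : Fin n → ℝ) (θr : Fin p → ℝ)
    (P : Matrix (Fin n) (Fin n) ℝ) (hP : P.PosDef)
    (Q : Matrix (Fin n) (Fin n) ℝ) (hQdef : Q = P - Aᵀ * P * A) (hQ : Q.PosDef)
    (lminQ : ℝ) (hlmin : IsLeast (Set.range hQ.1.eigenvalues) lminQ)
    (f : (Fin p → ℝ) → (Fin n → ℝ) → ℝ) (hf0 : f 0 0 = 0)
    (Kr : Fin p → ℝ) (hKr : ∀ i, 0 ≤ Kr i)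
    (Ku : Fin n → ℝ) (hKu : ∀ i, 0 ≤ Ku i)
    (hfLip : ∀ (r r' : Fin p → ℝ) (x x' : Fin n → ℝ),
      |f r x - f r' x'| ≤ (∑ i, Kr i * |r i - r' i|) + (∑ i, Ku i * |x i - x' i|))
    (β β₁ β₂ : ℝ) (hβ : 0 < β) (hβ₁ : 0 < β₁) (hβ₂ : 0 < β₂)
    (cβ : ℝ)
    (hcβ : cβ = B ⬝ᵥ P.mulVec B
        + (1 / (β * lminQ)) * (B ⬝ᵥ (P * A * Aᵀ * P).mulVec B)) :
    ∀ (x : Fin n → ℝ) (r : Fin p → ℝ),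
      (A.mulVec x + (θr ⬝ᵥ r + f r x) • B) ⬝ᵥ
          P.mulVec (A.mulVec x + (θr ⬝ᵥ r + f r x) • B)
        - x ⬝ᵥ P.mulVec x
      ≤ -((1 - β) * lminQ - cβ * (1 + β₁) * (1 + β₂) * (Ku ⬝ᵥ Ku)) * (∑ i, (x i) ^ 2)
        + cβ * ((1 + β₁) * (1 + 1 / β₂) * (Kr ⬝ᵥ Kr) + (1 + 1 / β₁) * (θr ⬝ᵥ θr))
            * (∑ i, (r i) ^ 2) := by
  intro x r
  have hl : 0 < lminQ := by
    obtain ⟨i, hi⟩ := hlmin.1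
    exact hi ▸ hQ.eigenvalues_pos i
  have hPt : Pᵀ = P := by simpa using hP.1.eq
  have hu : B ⬝ᵥ (P * A * Aᵀ * P) *ᵥ B = ((Aᵀ * P) *ᵥ B) ⬝ᵥ ((Aᵀ * P) *ᵥ B) := by
    rw [dotProduct_mulVec _ (Aᵀ * P), ← mulVec_transpose, mulVec_mulVec, dotProduct_comm]
    simp [hPt, Matrix.mul_assoc]
  have hx : ∑ i, x i ^ 2 = x ⬝ᵥ x := by simp [dotProduct, sq]
  have hBP : 0 ≤ B ⬝ᵥ P *ᵥ B := by simpa using hP.posSemidef.dotProduct_mulVec_nonneg B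
  have huu : 0 ≤ ((Aᵀ * P) *ᵥ B) ⬝ᵥ ((Aᵀ * P) *ᵥ B) := by
    simpa using dotProduct_star_self_nonneg ((Aᵀ * P) *ᵥ B)
  have hc : 0 ≤ cβ := by
    rw [hcβ, hu]
    positivity
  have hfa : |f r x| ≤ ∑ i, Ku i * |x i| + ∑ i, Kr i * |r i| := by
    simpa [hf0, add_comm] using hfLip r 0 x 0
  have hKx : (∑ i, Ku i * |x i|) ^ 2 ≤ (Ku ⬝ᵥ Ku) * ∑ i, x i ^ 2 := by
    simpa [dotProduct, sq] using sum_mul_sq_le_sq_mul_sq univ Ku (fun i => |x i|)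
  have hKr' : (∑ i, Kr i * |r i|) ^ 2 ≤ (Kr ⬝ᵥ Kr) * ∑ i, r i ^ 2 := by
    simpa [dotProduct, sq] using sum_mul_sq_le_sq_mul_sq univ Kr (fun i => |r i|)
  have hθ : (θr ⬝ᵥ r) ^ 2 ≤ (θr ⬝ᵥ θr) * ∑ i, r i ^ 2 := by
    simpa [dotProduct, sq] using sum_mul_sq_le_sq_mul_sq univ θr r
  have hf : f r x ^ 2 ≤ (1 + β₂) * ((Ku ⬝ᵥ Ku) * ∑ i, x i ^ 2)
      + (1 + 1 / β₂) * ((Kr ⬝ᵥ Kr) * ∑ i, r i ^ 2) :=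
    calc f r x ^ 2 ≤ (∑ i, Ku i * |x i| + ∑ i, Kr i * |r i|) ^ 2 := by
          rw [← sq_abs]
          gcongr
      _ ≤ _ := add_sq_le_young hβ₂ _ _
      _ ≤ _ := by gcongr
  have hw : (θr ⬝ᵥ r + f r x) ^ 2 ≤
      (1 + β₁) * ((1 + β₂) * ((Ku ⬝ᵥ Ku) * ∑ i, x i ^ 2)
        + (1 + 1 / β₂) * ((Kr ⬝ᵥ Kr) * ∑ i, r i ^ 2))
      + (1 + 1 / β₁) * ((θr ⬝ᵥ θr) * ∑ i, r i ^ 2) := by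
    rw [add_comm (θr ⬝ᵥ r)]
    refine (add_sq_le_young hβ₁ _ _).trans ?_
    gcongr
  have hcw := mul_le_mul_of_nonneg_left hw hc
  have hQx := mul_dotProduct_self_le_of_le_eigenvalues hQ.1
    (fun i => hlmin.2 (Set.mem_range_self i)) x
  have hcross := two_mul_dotProduct_le_young (mul_pos hβ hl) (θr ⬝ᵥ r + f r x)
    ((Aᵀ * P) *ᵥ B) x
  rw [lyapunov_difference_eq hPt, ← hQdef]
  have hsplit : cβ * (θr ⬝ᵥ r + f r x) ^ 2 = (θr ⬝ᵥ r + f r x) ^ 2 * (B ⬝ᵥ P *ᵥ B)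
      + 1 / (β * lminQ) * (((Aᵀ * P) *ᵥ B) ⬝ᵥ ((Aᵀ * P) *ᵥ B)) * (θr ⬝ᵥ r + f r x) ^ 2 := by
    rw [hcβ, hu]
    ring
  rw [← hx] at hQx hcross
  linarith
end

section
/- Let A ∈ ℝ^{n×n}, B ∈ ℝ^n, θ_r ∈ ℝ^p, let P ∈ ℝ^{n×n} be symmetric positive definite with Q := P − AᵀPA positive definite, and let f : ℝ^p × ℝ^n → ℝ satisfy f(0, 0) = 0 and |f(r, x) − f(r′, x′)| ≤ K_rᵀ |r − r′| + K_uᵀ |x − x′| for all r, r′, x, x′, where K_r ∈ ℝ^p and K_u ∈ ℝ^n have nonnegative entries and |·| is the entrywise absolute value. Suppose there exists β > 0 such that K_uᵀ K_u < (1 − β) λ_min(Q) / c_β, where c_β := BᵀPB + (1/(β λ_min(Q))) BᵀPA AᵀP B. Then V(x) = xᵀPx is an ISS-Lyapunov function for the dynamics x⁺ = A x + B (θ_rᵀ r + f(r, x)): λ_min(P)‖x‖₂² ≤ V(x) ≤ λ_max(P)‖x‖₂² for all x, and there exist constants c₁ > 0 and c₂ ≥ 0 such that for all x ∈ ℝ^n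 and r ∈ ℝ^p, V(A x + B(θ_rᵀ r + f(r, x))) − V(x) ≤ −c₁ ‖x‖₂² + c₂ ‖r‖₂². -/
open Matrix Finset

open scoped MatrixOrder in
theorem Matrix.IsHermitian.mul_sum_sq_le_of_le_eigenvalues {n : ℕ}
    {H : Matrix (Fin n) (Fin n) ℝ} (hH : H.IsHermitian) {m : ℝ}
    (hm : ∀ i, m ≤ hH.eigenvalues i) (x : Fin n → ℝ) :
    m * ∑ i, x i ^ 2 ≤ x ⬝ᵥ H.mulVec x := by
  have hle : algebraMap ℝ (Matrix (Fin n) (Fin n) ℝ) m ≤ H := by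
    apply algebraMap_le_of_le_spectrum (ha := hH)
    rw [hH.spectrum_real_eq_range_eigenvalues]
    rintro _ ⟨i, rfl⟩
    exact hm i
  have h := (Matrix.le_iff.1 hle).dotProduct_mulVec_nonneg x
  simp only [Algebra.algebraMap_eq_smul_one, star_trivial, sub_mulVec, smul_mulVec, one_mulVec,
    dotProduct_sub, dotProduct_smul, smul_eq_mul, sub_nonneg] at h
  simpa only [dotProduct, pow_two] using h

open scoped MatrixOrder in
theorem Matrix.IsHermitian.le_mul_sum_sq_of_eigenvalues_le {n : ℕ}
    {H : Matrix (Fin n) (Fin n) ℝ} (hH : H.IsHermitian) {m : ℝ}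
    (hm : ∀ i, hH.eigenvalues i ≤ m) (x : Fin n → ℝ) :
    x ⬝ᵥ H.mulVec x ≤ m * ∑ i, x i ^ 2 := by
  have hle : H ≤ algebraMap ℝ (Matrix (Fin n) (Fin n) ℝ) m := by
    apply le_algebraMap_of_spectrum_le (ha := hH)
    rw [hH.spectrum_real_eq_range_eigenvalues]
    rintro _ ⟨i, rfl⟩
    exact hm i
  have h := (Matrix.le_iff.1 hle).dotProduct_mulVec_nonneg x
  simp only [Algebra.algebraMap_eq_smul_one, star_trivial, sub_mulVec, smul_mulVec, one_mulVec,
    dotProduct_sub, dotProduct_smul, smul_eq_mul, sub_nonneg] at h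
  simpa only [dotProduct, pow_two] using h

/-- Weighted Young inequality for the square of a sum. -/
theorem add_sq_le_weighted (a b : ℝ) {ε : ℝ} (hε : 0 < ε) :
    (a + b) ^ 2 ≤ (1 + ε) * a ^ 2 + (1 + 1 / ε) * b ^ 2 := by
  have h : (1 + ε) * a ^ 2 + (1 + 1 / ε) * b ^ 2 - (a + b) ^ 2 = (ε * a - b) ^ 2 / ε := by
    field_simp
    ring
  have : 0 ≤ (ε * a - b) ^ 2 / ε := by positivity
  linarith

/-- Young inequality for twice a scaled dot product. -/
theorem two_mul_mul_dotProduct_le {n : ℕ} (w x : Fin n → ℝ) (s : ℝ) {δ : ℝ} (hδ : 0 < δ) :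
    2 * s * (w ⬝ᵥ x) ≤ δ * ∑ i, x i ^ 2 + 1 / δ * (w ⬝ᵥ w) * s ^ 2 := by
  simp only [dotProduct, mul_sum, sum_mul, ← sum_add_distrib]
  refine sum_le_sum fun i _ => ?_
  have h : δ * x i ^ 2 + 1 / δ * (w i * w i) * s ^ 2 - 2 * s * (w i * x i)
      = (δ * x i - s * w i) ^ 2 / δ := by
    field_simp
    ring
  have : 0 ≤ (δ * x i - s * w i) ^ 2 / δ := by positivity
  linarith

/-- The one-step difference of a quadratic form along `x ↦ A x + s B`. -/
theorem quadratic_form_step {n : ℕ} (A P : Matrix (Fin n) (Fin n) ℝ) (hP : Pᵀ = P)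
    (B x : Fin n → ℝ) (s : ℝ) :
    (A.mulVec x + s • B) ⬝ᵥ P.mulVec (A.mulVec x + s • B) - x ⬝ᵥ P.mulVec x
      = -(x ⬝ᵥ (P - Aᵀ * P * A).mulVec x) + 2 * s * ((Aᵀ * P).mulVec B ⬝ᵥ x)
        + s ^ 2 * (B ⬝ᵥ P.mulVec B) := by
  have hAPA : x ⬝ᵥ (Aᵀ * P * A).mulVec x = A.mulVec x ⬝ᵥ P.mulVec (A.mulVec x) := by
    rw [Matrix.mul_assoc, ← mulVec_mulVec, ← mulVec_mulVec, dotProduct_mulVec, vecMul_transpose]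
  have hleft : A.mulVec x ⬝ᵥ P.mulVec B = (Aᵀ * P).mulVec B ⬝ᵥ x := by
    rw [← mulVec_mulVec, dotProduct_comm _ x, dotProduct_mulVec x, vecMul_transpose]
  have hright : B ⬝ᵥ P.mulVec (A.mulVec x) = (Aᵀ * P).mulVec B ⬝ᵥ x := by
    rw [← hleft, dotProduct_mulVec, ← mulVec_transpose, hP, dotProduct_comm]
  simp only [mulVec_add, mulVec_smul, add_dotProduct, dotProduct_add, smul_dotProduct,
    dotProduct_smul, smul_eq_mul, sub_mulVec, dotProduct_sub, hAPA, hleft, hright]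
  ring

theorem sq_sum_mul_abs_le {n : ℕ} (k x : Fin n → ℝ) :
    (∑ i, k i * |x i|) ^ 2 ≤ (k ⬝ᵥ k) * ∑ i, x i ^ 2 := by
  have h := sum_mul_sq_le_sq_mul_sq univ k (fun i => |x i|)
  simpa only [sq_abs, dotProduct, pow_two, abs_mul_abs_self] using h

/-- **ISS of the PGNN feedforward controller** (Theorem 1 of the paper).
If there exists `β > 0` with `K_uᵀK_u < (1 − β) λ_min(Q) / c_β`, then
`V(x) = xᵀPx` is an ISS-Lyapunov function for the closed-loop map
`x⁺ = A x + B (θ_rᵀ r + f(r, x))`: it is bounded between `λ_min(P)‖x‖₂²` and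
`λ_max(P)‖x‖₂²`, and its one-step difference is bounded by
`−c₁ ‖x‖₂² + c₂ ‖r‖₂²` with `c₁ > 0` and `c₂ ≥ 0`. -/
theorem pgnn_feedforward_iss {n p : ℕ}
    (A : Matrix (Fin n) (Fin n) ℝ) (B : Fin n → ℝ) (θr : Fin p → ℝ)
    (P : Matrix (Fin n) (Fin n) ℝ) (hP : P.PosDef)
    (Q : Matrix (Fin n) (Fin n) ℝ) (hQdef : Q = P - Aᵀ * P * A) (hQ : Q.PosDef)
    (lminQ : ℝ) (hlmin : IsLeast (Set.range hQ.1.eigenvalues) lminQ)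
    (pmin pmax : ℝ)
    (hpmin : IsLeast (Set.range hP.1.eigenvalues) pmin)
    (hpmax : IsGreatest (Set.range hP.1.eigenvalues) pmax)
    (f : (Fin p → ℝ) → (Fin n → ℝ) → ℝ) (hf0 : f 0 0 = 0)
    (Kr : Fin p → ℝ) (hKr : ∀ i, 0 ≤ Kr i)
    (Ku : Fin n → ℝ) (hKu : ∀ i, 0 ≤ Ku i)
    (hfLip : ∀ (r r' : Fin p → ℝ) (x x' : Fin n → ℝ),
      |f r x - f r' x'| ≤ (∑ i, Kr i * |r i - r' i|) + (∑ i, Ku i * |x i - x' i|))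
    (hcond : ∃ β > (0 : ℝ),
      Ku ⬝ᵥ Ku < (1 - β) * lminQ /
        (B ⬝ᵥ P.mulVec B
          + (1 / (β * lminQ)) * (B ⬝ᵥ (P * A * Aᵀ * P).mulVec B))) :
    (∀ x : Fin n → ℝ,
      pmin * (∑ i, (x i) ^ 2) ≤ x ⬝ᵥ P.mulVec x ∧
      x ⬝ᵥ P.mulVec x ≤ pmax * (∑ i, (x i) ^ 2)) ∧
    ∃ c₁ > (0 : ℝ), ∃ c₂ ≥ (0 : ℝ), ∀ (x : Fin n → ℝ) (r : Fin p → ℝ),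
      (A.mulVec x + (θr ⬝ᵥ r + f r x) • B) ⬝ᵥ
          P.mulVec (A.mulVec x + (θr ⬝ᵥ r + f r x) • B)
        - x ⬝ᵥ P.mulVec x
      ≤ -c₁ * (∑ i, (x i) ^ 2) + c₂ * (∑ i, (r i) ^ 2) := by
  obtain ⟨β, hβ, hcond⟩ := hcond
  have hPt : Pᵀ = P := by simpa using hP.1.eq
  refine ⟨fun x => ⟨hP.1.mul_sum_sq_le_of_le_eigenvalues (fun i => hpmin.2 ⟨i, rfl⟩) x,
    hP.1.le_mul_sum_sq_of_eigenvalues_le (fun i => hpmax.2 ⟨i, rfl⟩) x⟩, ?_⟩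
  have hl : 0 < lminQ := by
    obtain ⟨i, rfl⟩ := hlmin.1
    exact hQ.eigenvalues_pos i
  have hδ : 0 < β * lminQ := mul_pos hβ hl
  set w := (Aᵀ * P).mulVec B with hw
  have hww : B ⬝ᵥ (P * A * Aᵀ * P).mulVec B = w ⬝ᵥ w := by
    rw [Matrix.mul_assoc, ← mulVec_mulVec, dotProduct_mulVec, ← mulVec_transpose,
      transpose_mul, hPt]
  rw [hww] at hcond
  set c := B ⬝ᵥ P.mulVec B + 1 / (β * lminQ) * (w ⬝ᵥ w) with hc
  have hBPB : 0 ≤ B ⬝ᵥ P.mulVec B := by simpa using hP.posSemidef.dotProduct_mulVec_nonneg B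
  have hnonneg : ∀ {m : ℕ} (v : Fin m → ℝ), 0 ≤ v ⬝ᵥ v := fun v =>
    sum_nonneg fun i _ => mul_self_nonneg (v i)
  have hc0 : 0 ≤ c := add_nonneg hBPB (mul_nonneg (by positivity) (hnonneg w))
  set k := Ku ⬝ᵥ Ku with hk
  have hk0 : 0 ≤ k := hnonneg Ku
  have hcpos : 0 < c := by
    refine hc0.lt_of_ne fun h => ?_
    rw [← h, div_zero] at hcond
    linarith
  rw [lt_div_iff₀ hcpos] at hcond
  set d := (1 - β) * lminQ - k * c with hd
  have hdpos : 0 < d := sub_pos.2 hcond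
  set ε := d / (2 * (k * c + 1)) with hε
  have hkc : 0 ≤ k * c := mul_nonneg hk0 hc0
  have hεpos : 0 < ε := by positivity
  have hεk : ε * (k * c) ≤ d / 2 := by
    rw [hε, div_mul_eq_mul_div, div_le_div_iff₀ (by positivity) two_pos]
    nlinarith
  set M : Fin p → ℝ := fun i => |θr i| + Kr i with hM
  refine ⟨d / 2, by positivity, c * ((1 + 1 / ε) * (M ⬝ᵥ M)),
    mul_nonneg hc0 (mul_nonneg (by positivity) (hnonneg M)), fun x r => ?_⟩
  set s := θr ⬝ᵥ r + f r x with hs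
  have hsabs : |s| ≤ (∑ i, Ku i * |x i|) + ∑ i, M i * |r i| := by
    have hf : |f r x| ≤ (∑ i, Kr i * |r i|) + ∑ i, Ku i * |x i| := by
      simpa [hf0] using hfLip r 0 x 0
    have hθ : |θr ⬝ᵥ r| ≤ ∑ i, |θr i| * |r i| := by
      simpa only [dotProduct, abs_mul] using abs_sum_le_sum_abs (fun i => θr i * r i) univ
    have hsum : ∑ i, M i * |r i| = (∑ i, |θr i| * |r i|) + ∑ i, Kr i * |r i| := by
      simp only [hM, add_mul, sum_add_distrib]
    linarith [abs_add_le (θr ⬝ᵥ r) (f r x)]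
  have hs2 : s ^ 2 ≤ (1 + ε) * (k * ∑ i, x i ^ 2)
      + (1 + 1 / ε) * ((M ⬝ᵥ M) * ∑ i, r i ^ 2) :=
    calc s ^ 2 = |s| ^ 2 := (sq_abs s).symm
      _ ≤ ((∑ i, Ku i * |x i|) + ∑ i, M i * |r i|) ^ 2 := by gcongr
      _ ≤ _ := add_sq_le_weighted _ _ hεpos
      _ ≤ _ := by
        gcongr
        · exact sq_sum_mul_abs_le Ku x
        · exact sq_sum_mul_abs_le M r
  have hQx := hQ.1.mul_sum_sq_le_of_le_eigenvalues (fun i => hlmin.2 ⟨i, rfl⟩) x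
  have hyoung := two_mul_mul_dotProduct_le w x s hδ
  have hX : 0 ≤ ∑ i, x i ^ 2 := sum_nonneg fun i _ => sq_nonneg (x i)
  rw [quadratic_form_step A P hPt, ← hQdef, ← hw]
  calc -(x ⬝ᵥ Q.mulVec x) + 2 * s * (w ⬝ᵥ x) + s ^ 2 * (B ⬝ᵥ P.mulVec B)
      ≤ -((1 - β) * lminQ) * (∑ i, x i ^ 2) + c * s ^ 2 := by
        rw [hc]
        linarith
    _ ≤ -((1 - β) * lminQ) * (∑ i, x i ^ 2) + c * ((1 + ε) * (k * ∑ i, x i ^ 2)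
          + (1 + 1 / ε) * ((M ⬝ᵥ M) * ∑ i, r i ^ 2)) := by gcongr
    _ = (-d + ε * (k * c)) * (∑ i, x i ^ 2)
          + c * ((1 + 1 / ε) * (M ⬝ᵥ M)) * ∑ i, r i ^ 2 := by
        rw [hd]
        ring
    _ ≤ _ := by
        gcongr
        linarith
end
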